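/- Let n ≥ 3 and let ℚ(q) be the field of rational functions over ℚ in an indeterminate q. Call κ ∈ ℚ(q)ˣ generic if for every integer k > 0 the n×n matrix G(n,k,κ) is invertible. If κ ∈ ℚ(q)ˣ is not generic, then κ ∈ {q, −q, q^{−1}, −q^{−1}}. -/

import Mathlib

noncomputable section

/-- The `q`-integer `[m] = (q^m - q^{-m})/(q - q^{-1})`. -/
def qint (F : Type*) [Field F] (q : Fˣ) (m : ℤ) : F :=
  (((q ^ m : Fˣ) : F) - ((q ^ (-m) : Fˣ) : F)) / ((q : F) - ((q⁻¹ : Fˣ) : F))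

/-- The affine Cartan matrix of type `A_{n-1}^{(1)}`. -/
def aMat (n : ℕ) (i j : Fin n) : ℤ :=
  if i = j then 2
  else if (j : ZMod n) = (i : ZMod n) + 1 ∨ (j : ZMod n) = (i : ZMod n) - 1 then -1
  else 0

/-- The matrix `(m_{ij})`. -/
def mMat (n : ℕ) (i j : Fin n) : ℤ :=
  if (j : ZMod n) = (i : ZMod n) + 1 then -1
  else if (j : ZMod n) = (i : ZMod n) - 1 then 1
  else 0

/-- The matrix `G(n,k,κ)` with entries `[k⬝a_{ij}]⬝κ^{-k⬝m_{ij}}`. -/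
def Gmat (F : Type*) [Field F] (n : ℕ) (q κ : Fˣ) (k : ℤ) : Matrix (Fin n) (Fin n) F :=
  fun i j => qint F q (k * aMat n i j) * ((κ ^ (-(k * mMat n i j)) : Fˣ) : F)

/-- The indeterminate `q`, as a unit of the rational function field `ℚ(q)`. -/
def qX : (RatFunc ℚ)ˣ := Units.mk0 RatFunc.X RatFunc.X_ne_zero

theorem qint_neg (F : Type*) [Field F] (q : Fˣ) (m : ℤ) : qint F q (-m) = -qint F q m := by
  rw [qint, qint, neg_neg, ← neg_div, neg_sub]

theorem qint_two_mul (F : Type*) [Field F] (q : Fˣ) (k : ℤ) :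
    qint F q (k * 2) = qint F q k * (((q ^ k : Fˣ) : F) + ((q ^ (-k) : Fˣ) : F)) := by
  simp only [qint, mul_two, neg_add, zpow_add, Units.val_mul]
  ring

theorem qint_ne_zero {F : Type*} [Field F] {q : Fˣ} (hq : ∀ m : ℕ, 0 < m → q ^ m ≠ 1)
    {k : ℤ} (hk : 0 < k) : qint F q k ≠ 0 := by
  have key : ∀ j : ℤ, 0 < j → ((q ^ j : Fˣ) : F) - ((q ^ (-j) : Fˣ) : F) ≠ 0 := by
    intro j hj h
    lift j to ℕ using hj.le
    have h' : q ^ (j : ℤ) = q ^ (-(j : ℤ)) := Units.ext (sub_eq_zero.1 h)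
    refine hq (j + j) (by omega) ?_
    rw [pow_add, ← zpow_natCast]
    nth_rw 2 [h']
    rw [zpow_neg, mul_inv_cancel]
  have h1 := key 1 one_pos
  rw [zpow_one, zpow_neg_one] at h1
  exact div_ne_zero (key k hk) h1

theorem Gmat_apply (F : Type*) [Field F] (m : ℕ) (q κ : Fˣ) (k : ℤ) (i j : Fin (m + 3)) :
    Gmat F (m + 3) q κ k i j = qint F q k *
      ((if j = i then ((q ^ k : Fˣ) : F) + ((q ^ (-k) : Fˣ) : F) else 0)
        - (if j = i + 1 then ((κ ^ k : Fˣ) : F) else 0)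
        - (if j = i - 1 then ((κ ^ (-k) : Fˣ) : F) else 0)) := by
  have hcast (x : Fin (m + 3)) : ((x : ℕ) : ZMod (m + 3)) = x :=
    ZMod.natCast_zmod_val (n := m + 3) x
  have h1 : ((j : ℕ) : ZMod (m + 3)) = ((i : ℕ) : ZMod (m + 3)) + 1 ↔ j = i + 1 := by
    rw [hcast, hcast]; rfl
  have h2 : ((j : ℕ) : ZMod (m + 3)) = ((i : ℕ) : ZMod (m + 3)) - 1 ↔ j = i - 1 := by
    rw [hcast, hcast]; rfl
  have one_ne : (1 : Fin (m + 3)) ≠ 0 := by simp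
  have two_ne : (1 : Fin (m + 3)) + 1 ≠ 0 := by
    simp [Fin.ext_iff, Fin.val_add, Nat.mod_eq_of_lt]
  have hne1 : i ≠ i + 1 := fun h => one_ne (by simp at h)
  have hne2 : i ≠ i - 1 := fun h => one_ne (by rwa [eq_comm, sub_eq_self] at h)
  have hne3 : i + 1 ≠ i - 1 := fun h => two_ne (by
    rw [eq_sub_iff_add_eq, add_assoc] at h; simpa using h)
  simp only [Gmat, aMat, mMat, h1, h2]
  by_cases hi : j = i
  · subst hi
    simp [hne1, hne2, qint_two_mul]
  by_cases hi1 : j = i + 1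
  · subst hi1
    simp [hne3, hne1, Ne.symm hne1, qint_neg]
  by_cases hi2 : j = i - 1
  · subst hi2
    simp [hne2, Ne.symm hne2, Ne.symm hne3, qint_neg]
  · simp [hi, hi1, hi2, Ne.symm hi, qint]

theorem pow_eq_one_of_cyclic_recurrence {F : Type*} [Field F] {n : ℕ} [NeZero n] {c : F}
    {f : Fin n → F} (hf : f ≠ 0) (h : ∀ i, f (i + 1) = c * f i) : c ^ n = 1 := by
  obtain ⟨i, hi⟩ := Function.ne_iff.1 hf
  have key : ∀ t : ℕ, f (i + t • 1) = c ^ t * f i := by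
    intro t
    induction t with
    | zero => simp
    | succ t ih => rw [succ_nsmul, ← add_assoc, h, ih, pow_succ', mul_assoc]
  have hn := key n
  have hn1 : n • (1 : Fin n) = 0 := by simpa using card_nsmul_eq_zero' (x := (1 : Fin n))
  rw [hn1, add_zero] at hn
  exact mul_right_cancel₀ hi (by rw [← hn, one_mul])

theorem pow_eq_of_not_isUnit_Gmat {F : Type*} [Field F] {n : ℕ} (hn : 3 ≤ n) {q κ : Fˣ} {k : ℤ}
    (hk : qint F q k ≠ 0) (hG : ¬ IsUnit (Gmat F n q κ k)) :
    ((κ / q) ^ k) ^ n = 1 ∨ ((κ / q⁻¹) ^ k) ^ n = 1 := by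
  obtain ⟨m, rfl⟩ := Nat.exists_eq_add_of_le' hn
  rw [Matrix.isUnit_iff_isUnit_det, isUnit_iff_ne_zero, not_not] at hG
  obtain ⟨v, hv, hGv⟩ := Matrix.exists_mulVec_eq_zero_iff.2 hG
  have hrec (i : Fin (m + 3)) : (((q ^ k : Fˣ) : F) + ((q ^ (-k) : Fˣ) : F)) * v i
      - ((κ ^ k : Fˣ) : F) * v (i + 1) - ((κ ^ (-k) : Fˣ) : F) * v (i - 1) = 0 := by
    have h := congrFun hGv i
    simp only [Matrix.mulVec, dotProduct, Gmat_apply, mul_assoc, ← Finset.mul_sum, sub_mul, ite_mul,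
      zero_mul, Finset.sum_sub_distrib, Finset.sum_ite_eq', Finset.mem_univ, if_true,
      Pi.zero_apply, mul_eq_zero, hk, false_or] at h
    exact h
  simp only [zpow_neg, Units.val_inv_eq_inv_val] at hrec
  rw [div_zpow, div_zpow, inv_zpow]
  generalize κ ^ k = K at hrec ⊢
  generalize q ^ k = Q at hrec ⊢
  have hK := K.ne_zero
  have hQ := Q.ne_zero
  let u : Fin (m + 3) → F := fun i => K * v (i + 1) - (Q : F)⁻¹ * v i
  by_cases hu : u = 0
  · right
    have h : ((Q : F)⁻¹ * (K : F)⁻¹) ^ (m + 3) = 1 :=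
      pow_eq_one_of_cyclic_recurrence hv fun i => by
        have hi : K * v (i + 1) - (Q : F)⁻¹ * v i = 0 := congrFun hu i
        field_simp at hi ⊢
        linear_combination hi
    rw [div_inv_eq_mul, ← inv_eq_one, ← inv_pow]
    refine Units.ext ?_
    simpa [mul_comm] using h
  · left
    have h : ((Q : F) * (K : F)⁻¹) ^ (m + 3) = 1 :=
      pow_eq_one_of_cyclic_recurrence hu fun i => by
        have hi := hrec (i + 1)
        rw [add_sub_cancel_right] at hi
        simp only [u]
        field_simp at hi ⊢
        linear_combination -hi
    rw [← inv_eq_one, ← inv_pow, inv_div]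
    refine Units.ext ?_
    simpa [div_eq_mul_inv] using h

theorem RatFunc.eq_one_or_eq_neg_one_of_pow_eq_one {x : RatFunc ℚ} {N : ℕ} (hN : N ≠ 0)
    (hx : x ^ N = 1) : x = 1 ∨ x = -1 := by
  obtain ⟨p, rfl⟩ := IsIntegrallyClosed.exists_algebraMap_eq_of_isIntegral_pow
    (R := Polynomial ℚ) (Nat.pos_of_ne_zero hN) (hx ▸ isIntegral_one)
  have hp : p ^ N = 1 := IsFractionRing.injective (Polynomial ℚ) (RatFunc ℚ) (by simpa using hx)
  obtain ⟨c, -, rfl⟩ := Polynomial.isUnit_iff.1 (IsUnit.of_pow_eq_one hp hN)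
  have hc : c ^ N = 1 := Polynomial.C_injective (by simpa using hp)
  rcases (pow_eq_one_iff_cases.1 hc) with h | h | ⟨h, -⟩
  · exact absurd h hN
  · simp [h]
  · simp [h]

theorem qX_pow_ne_one {m : ℕ} (hm : 0 < m) : qX ^ m ≠ 1 := by
  intro h
  have h' : (RatFunc.X : RatFunc ℚ) ^ m = 1 :=
    (Units.val_pow_eq_pow_val qX m).symm.trans (congrArg Units.val h)
  have hp : (Polynomial.X : Polynomial ℚ) ^ m = 1 :=
    IsFractionRing.injective (Polynomial ℚ) (RatFunc ℚ) (by simpa using h')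
  have hd := congrArg Polynomial.natDegree hp
  rw [Polynomial.natDegree_X_pow, Polynomial.natDegree_one] at hd
  omega

theorem RatFunc.eq_or_eq_neg_of_div_zpow_pow_eq_one {x y : (RatFunc ℚ)ˣ} {k : ℤ} (hk : 0 < k)
    {n : ℕ} (hn : n ≠ 0) (h : ((x / y) ^ k) ^ n = 1) : x = y ∨ x = -y := by
  lift k to ℕ using hk.le
  rw [zpow_natCast, ← pow_mul] at h
  have hN : k * n ≠ 0 := mul_ne_zero (by omega) hn
  rcases RatFunc.eq_one_or_eq_neg_one_of_pow_eq_one hN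
    ((Units.val_pow_eq_pow_val _ _).symm.trans (congrArg Units.val h)) with h | h
  · exact Or.inl (div_eq_one.1 (Units.ext h))
  · right
    have h' : x / y = -1 := Units.ext h
    rw [div_eq_iff_eq_mul.1 h', neg_one_mul]

theorem statement1 (n : ℕ) (hn : 3 ≤ n) (κ : (RatFunc ℚ)ˣ)
    (hκ : ¬ ∀ k : ℤ, 0 < k → IsUnit (Gmat (RatFunc ℚ) n qX κ k)) :
    κ = qX ∨ κ = -qX ∨ κ = qX⁻¹ ∨ κ = -qX⁻¹ := by
  push Not at hκ
  obtain ⟨k, hk, hG⟩ := hκ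
  have hn0 : n ≠ 0 := by omega
  rcases pow_eq_of_not_isUnit_Gmat hn (qint_ne_zero (fun _ => qX_pow_ne_one) hk) hG with h | h
  · rcases RatFunc.eq_or_eq_neg_of_div_zpow_pow_eq_one hk hn0 h with h | h <;> simp [h]
  · rcases RatFunc.eq_or_eq_neg_of_div_zpow_pow_eq_one hk hn0 h with h | h <;> simp [h]
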